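/- (Theorem 3, asymptotic expansion of the unstable eigenvalue for κ = 1.) Let e₀ ∈ l²(ℤ, ℝ) be the Kronecker delta sequence at site 0, and let 0 < a < b < √2. There exist ε₀ > 0 and C > 0 such that for every ε ∈ (0, ε₀), every p ∈ [a, b], and every solution ψ ∈ l²(ℤ, ℝ) of the stationary 1D dNLS equation with μ = 1 satisfying ψ_m > 0 for all m and ‖ψ − e₀‖_{l²} ≤ 2ε, there exist λ > 0 and a nonzero pair (U, W) ∈ l²(ℤ, ℝ)² with L₊(p)U = −λW, L₋(p)W = λU (stripe-lattice operators with μ = 1 and κ = 1), such that |λ − p√(2 − p²)| ≤ Cε. -/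

import Mathlib

section BanachPerturbation

variable {E : Type*} [NormedAddCommGroup E] [NormedSpace ℝ E]

/-- A simple isolated eigenvalue of a rank-one perturbation of a multiple of the identity persists
under a small bounded perturbation `Q`, in the form of a fixed-point equation for the
eigenvector normalized by `φ`. -/
theorem exists_normalized_perturbed_eigenvector [CompleteSpace E] (φ : E →L[ℝ] ℝ) (e : E)
    (Q : E →L[ℝ] E) {c : ℝ} (hφ : ‖φ‖ ≤ 1) (he : ‖e‖ ≤ 1) (hφe : φ e = 1) (hc : 1 ≤ c)
    (hQ : ‖Q‖ ≤ 1 / 6) :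
    ∃ w : E, φ w = 1 ∧ ‖w‖ ≤ 2 ∧ c • (w - e) = φ (Q w) • w - Q w := by
  set S : Set E := {w | φ w = 1 ∧ ‖w‖ ≤ 2}
  set F : E → E := fun w => e + c⁻¹ • (φ (Q w) • w - Q w) with hF
  have hc0 : (0 : ℝ) < c := by linarith
  have hc1 : c⁻¹ ≤ 1 := inv_le_one_of_one_le₀ hc
  have hφ' : ∀ x, ‖φ x‖ ≤ ‖x‖ := fun x => by
    simpa using φ.le_of_opNorm_le hφ x
  have hQ' : ∀ x, ‖Q x‖ ≤ 1 / 6 * ‖x‖ := fun x => Q.le_of_opNorm_le hQ x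
  have hcs : ∀ x : E, ‖c⁻¹ • x‖ ≤ ‖x‖ := fun x => by
    rw [norm_smul, Real.norm_of_nonneg (by positivity)]
    exact mul_le_of_le_one_left (norm_nonneg _) hc1
  have hSc : IsComplete S := by
    refine IsClosed.isComplete (IsClosed.inter ?_ ?_)
    · exact isClosed_eq φ.continuous continuous_const
    · exact isClosed_le continuous_norm continuous_const
  have hmaps : Set.MapsTo F S S := by
    rintro w ⟨hw1, hw2⟩
    refine ⟨by simp [hF, hφe, hw1], ?_⟩
    have h1 : ‖Q w‖ ≤ 1 / 3 := (hQ' w).trans (by linarith)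
    have h2 : ‖φ (Q w) • w‖ ≤ 1 / 3 * 2 := by
      rw [norm_smul]
      exact mul_le_mul ((hφ' _).trans h1) hw2 (norm_nonneg _) (by norm_num)
    calc ‖F w‖ ≤ ‖e‖ + ‖c⁻¹ • (φ (Q w) • w - Q w)‖ := norm_add_le _ _
      _ ≤ 1 + (‖φ (Q w) • w‖ + ‖Q w‖) := add_le_add he ((hcs _).trans (norm_sub_le _ _))
      _ ≤ 2 := by linarith
  have hlip : ContractingWith (5 / 6) (hmaps.restrict F S S) := by
    refine ⟨?_, LipschitzWith.of_dist_le_mul ?_⟩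
    · rw [← NNReal.coe_lt_coe]; norm_num
    rintro ⟨v, hv1, hv2⟩ ⟨w, hw1, hw2⟩
    rw [Subtype.dist_eq, Subtype.dist_eq, dist_eq_norm, dist_eq_norm]
    change ‖F v - F w‖ ≤ _ * ‖v - w‖
    have hdiff : F v - F w
        = c⁻¹ • ((φ (Q v) • (v - w) + φ (Q (v - w)) • w) - Q (v - w)) := by
      simp only [hF, map_sub, smul_sub, sub_smul, smul_add]
      abel
    have hd := norm_nonneg (v - w)
    have h1 : ‖φ (Q v) • (v - w)‖ ≤ 1 / 3 * ‖v - w‖ := by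
      rw [norm_smul]
      have := (hφ' _).trans (hQ' v)
      exact mul_le_mul_of_nonneg_right (by linarith) hd
    have h2 : ‖φ (Q (v - w)) • w‖ ≤ 1 / 6 * ‖v - w‖ * 2 := by
      rw [norm_smul]
      exact mul_le_mul ((hφ' _).trans (hQ' _)) hw2 (norm_nonneg _) (by positivity)
    have h3 := hQ' (v - w)
    have hK : ((5 / 6 : NNReal) : ℝ) = 5 / 6 := by norm_num
    rw [hdiff, hK]
    refine (hcs _).trans ((norm_sub_le _ _).trans ?_)
    have h4 := norm_add_le (φ (Q v) • (v - w)) (φ (Q (v - w)) • w)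
    linarith
  obtain ⟨w, ⟨hw1, hw2⟩, hfix, -⟩ :=
    hlip.exists_fixedPoint' hSc hmaps (x := e) ⟨hφe, he.trans one_le_two⟩ (edist_ne_top _ _)
  refine ⟨w, hw1, hw2, ?_⟩
  have hfix' : w - e = c⁻¹ • (φ (Q w) • w - Q w) := by
    rw [sub_eq_iff_eq_add']; exact hfix.symm
  rw [hfix', smul_inv_smul₀ hc0.ne']

/-- For small bounded perturbations `R₊`, `R₋` of the decoupled operators
`(1 + q) - 3 φ(·) e` and `(1 + q) - φ(·) e`, the product of the perturbed operators has an
eigenvalue close to `-q (2 - q)`. -/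
theorem exists_eigenvector_comp_rankOne_perturbation [CompleteSpace E] (φ : E →L[ℝ] ℝ) (e : E)
    (Rp Rm Lp Lm : E →L[ℝ] E) {q η : ℝ} (hφ : ‖φ‖ ≤ 1) (he : ‖e‖ ≤ 1) (hφe : φ e = 1)
    (hq0 : 0 ≤ q) (hq2 : q ≤ 2) (hη : η ≤ 1 / 66) (hRp : ‖Rp‖ ≤ η) (hRm : ‖Rm‖ ≤ η)
    (hLp : ∀ x, Lp x = (1 + q) • x - (3 * φ x) • e + Rp x)
    (hLm : ∀ x, Lm x = (1 + q) • x - φ x • e + Rm x) :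
    ∃ (ν : ℝ) (w : E), φ w = 1 ∧ |ν - q * (2 - q)| ≤ 22 * η ∧ Lp (Lm w) = -ν • w := by
  have hη0 : 0 ≤ η := (norm_nonneg _).trans hRp
  set Q : E →L[ℝ] E :=
    Lp ∘L Lm - ((1 + q) ^ 2 • ContinuousLinearMap.id ℝ E - (1 + 4 * q) • φ.smulRight e) with hQdef
  have hφ' : ∀ x, ‖φ x‖ ≤ ‖x‖ := fun x => by
    simpa using φ.le_of_opNorm_le hφ x
  have hφe' : ∀ x, ‖φ x • e‖ ≤ ‖x‖ := fun x => by
    rw [norm_smul]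
    simpa using mul_le_mul (hφ' x) he (norm_nonneg _) (norm_nonneg _)
  have hsm : ∀ x : E, ‖(1 + q) • x‖ ≤ 3 * ‖x‖ := fun x => by
    rw [norm_smul, Real.norm_of_nonneg (by linarith)]
    exact mul_le_mul_of_nonneg_right (by linarith) (norm_nonneg _)
  have hQ : ‖Q‖ ≤ 11 * η := by
    refine Q.opNorm_le_bound (by linarith) fun x => ?_
    have hx : Q x = ((1 + q) • Rm x - (3 : ℝ) • (φ (Rm x) • e))
        + Rp ((1 + q) • x - φ x • e + Rm x) := by
      simp only [hQdef, sub_apply, ContinuousLinearMap.comp_apply,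
        smul_apply, ContinuousLinearMap.smulRight_apply,
        ContinuousLinearMap.id_apply, hLp, hLm, map_add, map_sub, map_smul, hφe, smul_eq_mul]
      module
    have hn := norm_nonneg x
    have h1 : ‖Rm x‖ ≤ η * ‖x‖ := Rm.le_of_opNorm_le hRm x
    have h2 : ‖(3 : ℝ) • (φ (Rm x) • e)‖ ≤ 3 * ‖Rm x‖ := by
      rw [norm_smul, Real.norm_of_nonneg (by norm_num)]
      linarith [hφe' (Rm x)]
    have h3 : ‖(1 + q) • x - φ x • e + Rm x‖ ≤ 5 * ‖x‖ := by
      have h4 := norm_add_le ((1 + q) • x - φ x • e) (Rm x)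
      have h5 := norm_sub_le ((1 + q) • x) (φ x • e)
      have h6 : η * ‖x‖ ≤ 1 * ‖x‖ := mul_le_mul_of_nonneg_right (by linarith) hn
      linarith [hφe' x, hsm x]
    have h7 : ‖Rp ((1 + q) • x - φ x • e + Rm x)‖ ≤ η * (5 * ‖x‖) :=
      (Rp.le_of_opNorm_le hRp _).trans (mul_le_mul_of_nonneg_left h3 hη0)
    rw [hx]
    have h8 := norm_add_le ((1 + q) • Rm x - (3 : ℝ) • (φ (Rm x) • e))
      (Rp ((1 + q) • x - φ x • e + Rm x))
    have h9 := norm_sub_le ((1 + q) • Rm x) ((3 : ℝ) • (φ (Rm x) • e))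
    linarith [hsm (Rm x)]
  obtain ⟨w, hw1, hw2, hw3⟩ := exists_normalized_perturbed_eigenvector φ e Q
    (c := 1 + 4 * q) hφ he hφe (by linarith) (by linarith)
  refine ⟨q * (2 - q) - φ (Q w), w, hw1, ?_, ?_⟩
  · have h1 : ‖φ (Q w)‖ ≤ 11 * η * 2 := (hφ' _).trans
      ((Q.le_of_opNorm_le hQ w).trans (mul_le_mul_of_nonneg_left hw2 (by linarith)))
    rw [Real.norm_eq_abs] at h1
    rw [sub_sub_cancel_left, abs_neg]
    linarith
  · have h1 : Lp (Lm w) = Q w + ((1 + q) ^ 2 • w - (1 + 4 * q) • e) := by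
      simp [hQdef, hw1]
    linear_combination (norm := module) h1 + hw3

end BanachPerturbation

section WeightedShift

variable {ι : Type*}

theorem memℓp_two_iff_summable_sq {f : ι → ℝ} : Memℓp f 2 ↔ Summable fun i => f i ^ 2 := by
  rw [memℓp_gen_iff (by norm_num)]
  simp

theorem norm_sq_eq_tsum_sq (f : lp (fun _ : ι => ℝ) 2) : ‖f‖ ^ 2 = ∑' i, f i ^ 2 := by
  simpa using lp.norm_rpow_eq_tsum (p := 2) (by norm_num) f

/-- Weighted composition operators with bounded weights are bounded on `ℓ²`. -/
theorem exists_weighted_composition_clm (g : ι → ℝ) (σ : Equiv.Perm ι) {B : ℝ} (hB : 0 ≤ B)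
    (hg : ∀ i, |g i| ≤ B) :
    ∃ T : lp (fun _ : ι => ℝ) 2 →L[ℝ] lp (fun _ : ι => ℝ) 2,
      ‖T‖ ≤ B ∧ ∀ f i, T f i = g i * f (σ i) := by
  have hsum : ∀ f : lp (fun _ : ι => ℝ) 2, Summable fun i => B ^ 2 * f (σ i) ^ 2 := fun f =>
    (σ.summable_iff.2 (memℓp_two_iff_summable_sq.1 (lp.memℓp f))).mul_left _
  have hle : ∀ (f : lp (fun _ : ι => ℝ) 2) i,
      (g i * f (σ i)) ^ 2 ≤ B ^ 2 * f (σ i) ^ 2 := fun f i => by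
    rw [mul_pow, ← sq_abs (g i)]
    have := hg i
    gcongr
  have hmem : ∀ f : lp (fun _ : ι => ℝ) 2, Memℓp (fun i => g i * f (σ i)) 2 := fun f =>
    memℓp_two_iff_summable_sq.2
      ((hsum f).of_nonneg_of_le (fun _ => sq_nonneg _) (hle f))
  let T : lp (fun _ : ι => ℝ) 2 →ₗ[ℝ] lp (fun _ : ι => ℝ) 2 :=
    { toFun := fun f => ⟨fun i => g i * f (σ i), hmem f⟩
      map_add' := fun f h => by
        ext i
        change g i * (f (σ i) + h (σ i)) = g i * f (σ i) + g i * h (σ i)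
        ring
      map_smul' := fun a f => by
        ext i
        change g i * (a * f (σ i)) = a * (g i * f (σ i))
        ring }
  have hT : ∀ f, ‖T f‖ ≤ B * ‖f‖ := fun f => by
    refine le_of_sq_le_sq ?_ (by positivity)
    rw [norm_sq_eq_tsum_sq, mul_pow, norm_sq_eq_tsum_sq f,
      ← σ.tsum_eq (fun i => f i ^ 2), ← tsum_mul_left]
    exact ((hsum f).of_nonneg_of_le (fun _ => sq_nonneg _) (hle f)).tsum_le_tsum (hle f) (hsum f)
  exact ⟨T.mkContinuous B hT, T.mkContinuous_norm_le hB hT, fun _ _ => rfl⟩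

end WeightedShift

/-- A small discrete Schrödinger operator `-ε Δ + v` is bounded on `ℓ²(ℤ)` by `4 ε + sup |v|`. -/
theorem exists_discreteSchrodinger_clm {ε B : ℝ} (hε : 0 ≤ ε) (hB : 0 ≤ B) (v : ℤ → ℝ)
    (hv : ∀ m, |v m| ≤ B) :
    ∃ R : lp (fun _ : ℤ => ℝ) 2 →L[ℝ] lp (fun _ : ℤ => ℝ) 2, ‖R‖ ≤ 4 * ε + B ∧
      ∀ f m, R f m = -ε * (f (m + 1) + f (m - 1) - 2 * f m) + v m * f m := by
  obtain ⟨T₁, hT₁, h₁⟩ := exists_weighted_composition_clm (fun _ : ℤ => -ε) (Equiv.addRight 1) hε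
    (fun _ => by simp [abs_of_nonneg hε])
  obtain ⟨T₂, hT₂, h₂⟩ := exists_weighted_composition_clm (fun _ : ℤ => -ε) (Equiv.subRight 1) hε
    (fun _ => by simp [abs_of_nonneg hε])
  obtain ⟨T₃, hT₃, h₃⟩ := exists_weighted_composition_clm (fun m => 2 * ε + v m) (Equiv.refl ℤ)
    (B := 2 * ε + B) (by linarith)
    (fun m => (abs_add_le _ _).trans (by
      rw [abs_of_nonneg (by linarith : 0 ≤ 2 * ε)]; linarith [hv m]))
  refine ⟨T₁ + T₂ + T₃, ?_, fun f m => ?_⟩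
  · linarith [norm_add₃_le (a := T₁) (b := T₂) (c := T₃)]
  · change T₁ f m + T₂ f m + T₃ f m = _
    rw [h₁, h₂, h₃]
    simp only [Equiv.coe_addRight, Equiv.subRight_apply, Equiv.refl_apply]
    ring

theorem abs_sub_single_le_of_sqrt_tsum_le {ψ : ℤ → ℝ} (hψ : Memℓp ψ 2) {r : ℝ}
    (h : Real.sqrt (∑' m : ℤ, (ψ m - if m = 0 then 1 else 0) ^ 2) ≤ r) (m : ℤ) :
    |ψ m - if m = 0 then 1 else 0| ≤ r := by
  have h1 : Memℓp (fun m : ℤ => ψ m - if m = 0 then 1 else 0) 2 := by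
    have h2 := hψ.sub (lp.memℓp (lp.single (E := fun _ : ℤ => ℝ) 2 0 1))
    convert h2 using 2 with m
    simp [Pi.single_apply]
  have h3 := (memℓp_two_iff_summable_sq.1 h1).le_tsum m (fun _ _ => sq_nonneg _)
  exact (Real.abs_le_sqrt h3).trans h


/-- Theorem 3 (asymptotic expansion of the unstable eigenvalue on the stripe lattice
with `κ = 1`). For transverse wavenumbers `p` in a compact subinterval `[a,b]` of
`(0,√2)` and the fundamental soliton `ψ ≈ e₀` (with `μ = 1`), the stripe-lattice
stability problem has a real eigenvalue `λ > 0` with `λ = p√(2-p²) + O(ε)`. -/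
theorem unstable_eigenvalue_expansion_stripe_kappa_plus (a b : ℝ)
    (ha : 0 < a) (hab : a < b) (hb : b < Real.sqrt 2) :
    ∃ ε₀ C : ℝ, 0 < ε₀ ∧ 0 < C ∧
      ∀ ε : ℝ, 0 < ε → ε < ε₀ →
      ∀ p : ℝ, p ∈ Set.Icc a b →
      ∀ ψ : ℤ → ℝ, Memℓp ψ 2 → (∀ m : ℤ, 0 < ψ m) →
      (∀ m : ℤ, -ψ m + ε * (ψ (m + 1) + ψ (m - 1) - 2 * ψ m) + (ψ m) ^ 3 = 0) →
      Real.sqrt (∑' m : ℤ, (ψ m - if m = 0 then 1 else 0) ^ 2) ≤ 2 * ε →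
      ∃ lam : ℝ, 0 < lam ∧ ∃ U W : ℤ → ℝ, Memℓp U 2 ∧ Memℓp W 2 ∧
        ¬(U = 0 ∧ W = 0) ∧
        (∀ m : ℤ, -ε * (U (m + 1) + U (m - 1) - 2 * U m)
          + (1 + p ^ 2) * U m - 3 * (ψ m) ^ 2 * U m = -lam * W m) ∧
        (∀ m : ℤ, -ε * (W (m + 1) + W (m - 1) - 2 * W m)
          + (1 + p ^ 2) * W m - (ψ m) ^ 2 * W m = lam * U m) ∧
        |lam - p * Real.sqrt (2 - p ^ 2)| ≤ C * ε := by
  have hb0 : 0 < b := ha.trans hab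
  have hb2 : b ^ 2 < 2 := (Real.lt_sqrt hb0.le).1 hb
  set d : ℝ := a ^ 2 * (2 - b ^ 2)
  have hd0 : 0 < d := mul_pos (by positivity) (by linarith)
  have hsd : 0 < Real.sqrt d := Real.sqrt_pos.2 hd0
  refine ⟨min (1 / 1848) (d / 616), 616 / Real.sqrt d, by positivity, by positivity, ?_⟩
  intro ε hε hε₀ p hp ψ hψ _ _ hnear
  obtain ⟨hap, hpb⟩ := hp
  have hε1 : ε < 1 / 1848 := hε₀.trans_le (min_le_left _ _)
  have hε2 : 616 * ε < d := by
    have := hε₀.trans_le (min_le_right _ _)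
    linarith
  have hp0 : 0 < p := ha.trans_le hap
  have hpb2 : p ^ 2 ≤ b ^ 2 := by gcongr
  have hap2 : a ^ 2 ≤ p ^ 2 := by gcongr
  have hdp : d ≤ p ^ 2 * (2 - p ^ 2) :=
    mul_le_mul hap2 (by linarith) (by linarith) (by positivity)
  have hv : ∀ m : ℤ, |(if m = 0 then 1 else 0) - ψ m ^ 2| ≤ 8 * ε := fun m => by
    have h := abs_le.1 (abs_sub_single_le_of_sqrt_tsum_le hψ hnear m)
    split_ifs at h ⊢ <;> rw [abs_le] <;> constructor <;> nlinarith
  set e : lp (fun _ : ℤ => ℝ) 2 := lp.single 2 0 1 with he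
  set φ : lp (fun _ : ℤ => ℝ) 2 →L[ℝ] ℝ := lp.evalCLM ℝ (fun _ : ℤ => ℝ) 2 0
  have hem : ∀ m, e m = if m = 0 then 1 else 0 := fun m => by simp [he, Pi.single_apply]
  have hφf : ∀ f, φ f = f 0 := fun _ => rfl
  have hφn : ‖φ‖ ≤ 1 := φ.opNorm_le_bound zero_le_one fun f => by
    simpa [hφf] using lp.norm_apply_le_norm (by norm_num) f 0
  have hen : ‖e‖ ≤ 1 := by simp [he, lp.norm_single]
  obtain ⟨Rp, hRp, hRp'⟩ := exists_discreteSchrodinger_clm hε.le (B := 24 * ε) (by linarith)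
    (fun m => 3 * ((if m = 0 then 1 else 0) - ψ m ^ 2)) (fun m => by
      rw [abs_mul, abs_of_pos (by norm_num : (0 : ℝ) < 3)]; linarith [hv m])
  obtain ⟨Rm, hRm, hRm'⟩ := exists_discreteSchrodinger_clm hε.le (B := 8 * ε) (by linarith)
    (fun m => (if m = 0 then 1 else 0) - ψ m ^ 2) hv
  set P := φ.smulRight e
  set I := ContinuousLinearMap.id ℝ (lp (fun _ : ℤ => ℝ) 2)
  set Lp := (1 + p ^ 2) • I - (3 : ℝ) • P + Rp
  set Lm := (1 + p ^ 2) • I - P + Rm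
  have hLpm : ∀ (f : lp (fun _ : ℤ => ℝ) 2) m, Lp f m = -ε * (f (m + 1) + f (m - 1) - 2 * f m)
      + (1 + p ^ 2) * f m - 3 * ψ m ^ 2 * f m := fun f m => by
    change (1 + p ^ 2) * f m - 3 * (f 0 * e m) + Rp f m = _
    rw [hRp', hem]
    split_ifs with h
    · subst h; ring
    · ring
  have hLmm : ∀ (f : lp (fun _ : ℤ => ℝ) 2) m, Lm f m = -ε * (f (m + 1) + f (m - 1) - 2 * f m)
      + (1 + p ^ 2) * f m - ψ m ^ 2 * f m := fun f m => by
    change (1 + p ^ 2) * f m - f 0 * e m + Rm f m = _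
    rw [hRm', hem]
    split_ifs with h
    · subst h; ring
    · ring
  obtain ⟨ν, w, hw, hν, hνw⟩ := exists_eigenvector_comp_rankOne_perturbation φ e Rp Rm Lp Lm
    (q := p ^ 2) (η := 28 * ε) hφn hen (by simp [hφf, hem]) (by positivity) (by linarith)
    (by linarith) (by linarith) (by linarith)
    (fun x => by rw [mul_smul]; rfl) (fun x => rfl)
  have hν0 : 0 < ν := by linarith [(abs_le.1 hν).1]
  have hlam : 0 < Real.sqrt ν := Real.sqrt_pos.2 hν0
  have hlam2 : Real.sqrt ν ^ 2 = ν := Real.sq_sqrt hν0.le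
  refine ⟨Real.sqrt ν, hlam, ⇑((Real.sqrt ν)⁻¹ • Lm w), ⇑w, lp.memℓp _, lp.memℓp _, ?_, ?_, ?_, ?_⟩
  · rintro ⟨-, h⟩
    have : φ w = 0 := by rw [hφf, h]; rfl
    linarith
  · intro m
    rw [← hLpm, map_smul, hνw, smul_smul]
    change ((Real.sqrt ν)⁻¹ * -ν) * w m = _
    congr 1
    field_simp
    rw [hlam2]
  · intro m
    rw [← hLmm]
    change _ = Real.sqrt ν * ((Real.sqrt ν)⁻¹ * Lm w m)
    field_simp
  · have hμ0 : 0 ≤ 2 - p ^ 2 := by linarith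
    set μ := p * Real.sqrt (2 - p ^ 2) with hμ
    have hμ2 : μ ^ 2 = p ^ 2 * (2 - p ^ 2) := by rw [hμ, mul_pow, Real.sq_sqrt hμ0]
    have hμd : Real.sqrt d ≤ μ := by
      refine Real.sqrt_le_iff.2 ⟨by positivity, ?_⟩
      rw [hμ2]
      exact hdp
    rw [div_mul_eq_mul_div, le_div_iff₀ hsd]
    calc |Real.sqrt ν - μ| * Real.sqrt d ≤ |Real.sqrt ν - μ| * |Real.sqrt ν + μ| := by
          gcongr
          exact le_abs.2 (Or.inl (by linarith))
      _ = |ν - p ^ 2 * (2 - p ^ 2)| := by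
          rw [← abs_mul, ← hμ2]
          congr 1
          linear_combination hlam2
      _ ≤ 616 * ε := by linarith
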